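/- Let B = ℤ[√−5] (the ring of integers of ℚ(√−5)), let P = (2, 1+√−5)B, let a, b, c ∈ B, and let A = B[X,Y]/(aX² + bXY + cY² − 1). Then A is a smooth B-algebra if and only if b ∉ P, or a, b, c ∈ P. -/

import Mathlib

set_option synthInstance.maxHeartbeats 800000
set_option maxHeartbeats 1600000

open MvPolynomial

/-- `√−5` as a complex number. -/
noncomputable def sqrtm5 : ℂ := Real.sqrt 5 * Complex.I

/-- `B = ℤ[√−5]`, the ring of integers of `ℚ(√−5)`, realized as a subalgebra of `ℂ`. -/
noncomputable def B : Subalgebra ℤ ℂ := Algebra.adjoin ℤ {sqrtm5}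

/-- `√−5` as an element of `B`. -/
noncomputable def s : B := ⟨sqrtm5, Algebra.subset_adjoin rfl⟩

/-- The polynomial `a X² + b XY + c Y² - 1` in `B[X,Y]`. -/
noncomputable abbrev quadPoly (a b c : B) : MvPolynomial (Fin 2) B :=
  C a * X 0 ^ 2 + C b * X 0 * X 1 + C c * X 1 ^ 2 - 1

/-- The ring `A = B[X,Y]/(a X² + b XY + c Y² - 1)`. -/
noncomputable abbrev QuadAlg (a b c : B) :=
  MvPolynomial (Fin 2) B ⧸ Ideal.span {quadPoly a b c}

section Conic

universe u

variable {R : Type u} [CommRing R] {S : Type*} [CommRing S] [Algebra R S]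

/-- The polynomial `a X² + b XY + c Y² - 1` over a commutative ring. -/
noncomputable abbrev conicPoly (a b c : R) : MvPolynomial (Fin 2) R :=
  C a * X 0 ^ 2 + C b * X 0 * X 1 + C c * X 1 ^ 2 - 1

/-- The coordinate ring of the affine conic `a X² + b XY + c Y² = 1`. -/
noncomputable abbrev ConicAlg (a b c : R) :=
  MvPolynomial (Fin 2) R ⧸ Ideal.span {conicPoly a b c}

/-- The value of the form `a X² + b XY + c Y²` at `(x, y)`. -/
noncomputable def quadValue (a b c : R) (x y : S) : S :=
  algebraMap R S a * x ^ 2 + algebraMap R S b * x * y + algebraMap R S c * y ^ 2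

theorem aeval_conicPoly (a b c : R) (f : Fin 2 → S) :
    aeval f (conicPoly a b c) = quadValue a b c (f 0) (f 1) - 1 := by
  simp [conicPoly, quadValue, aeval_def]

theorem map_quadValue {T : Type*} [CommRing T] [Algebra R T] (φ : S →ₐ[R] T) (a b c : R)
    (x y : S) : φ (quadValue a b c x y) = quadValue a b c (φ x) (φ y) := by
  simp [quadValue]

theorem quadValue_swap (a b c : R) (x y : S) : quadValue a b c x y = quadValue c b a y x := by
  unfold quadValue; ring

theorem quadValue_X (a b c : R) :
    quadValue a b c (Ideal.Quotient.mkₐ R (Ideal.span {conicPoly a b c}) (X 0))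
      (Ideal.Quotient.mkₐ R (Ideal.span {conicPoly a b c}) (X 1)) = 1 := by
  rw [← map_quadValue, ← sub_eq_zero, ← map_one (Ideal.Quotient.mkₐ R _), ← map_sub,
    ← aeval_conicPoly a b c (X : Fin 2 → MvPolynomial (Fin 2) R), aeval_X_left_apply]
  exact Ideal.Quotient.eq_zero_iff_mem.mpr (Ideal.subset_span rfl)

/-- The morphism to `S` given by a point `(x, y)` with `a x² + b xy + c y² = 1`. -/
noncomputable def quadLift (a b c : R) (x y : S) (h : quadValue a b c x y = 1) :
    ConicAlg a b c →ₐ[R] S :=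
  Ideal.Quotient.liftₐ _ (aeval ![x, y]) fun p hp ↦ by
    obtain ⟨q, rfl⟩ := Ideal.mem_span_singleton.mp hp
    rw [map_mul, aeval_conicPoly]
    simp [h]

theorem quadLift_mk (a b c : R) (x y : S) (h : quadValue a b c x y = 1)
    (p : MvPolynomial (Fin 2) R) :
    quadLift a b c x y h (Ideal.Quotient.mkₐ R _ p) = aeval ![x, y] p := rfl

theorem finitePresentation_conicAlg (a b c : R) : Algebra.FinitePresentation R (ConicAlg a b c) :=
  Algebra.FinitePresentation.quotient ⟨{conicPoly a b c}, by simp⟩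

/-- Smoothness of the conic means that its points lift along square-zero ideals. -/
theorem smooth_conicAlg_iff_lift (a b c : R) :
    Algebra.Smooth R (ConicAlg a b c) ↔
      ∀ (S : Type u) [CommRing S] [Algebra R S] (I : Ideal S), I ^ 2 = ⊥ →
        ∀ x y : S, quadValue a b c x y - 1 ∈ I →
          ∃ x' y' : S, x' - x ∈ I ∧ y' - y ∈ I ∧ quadValue a b c x' y' = 1 := by
  constructor
  · intro h S _ _ I hI x y hxy
    have hq : quadValue a b c (Ideal.Quotient.mkₐ R I x) (Ideal.Quotient.mkₐ R I y) = 1 := by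
      rw [← map_quadValue, ← sub_eq_zero, ← map_one (Ideal.Quotient.mkₐ R I), ← map_sub]
      exact Ideal.Quotient.eq_zero_iff_mem.mpr hxy
    obtain ⟨g, hg⟩ := Algebra.FormallySmooth.comp_surjective R (ConicAlg a b c) I hI
      (quadLift a b c _ _ hq)
    refine ⟨g (Ideal.Quotient.mkₐ R _ (X 0)), g (Ideal.Quotient.mkₐ R _ (X 1)), ?_, ?_, ?_⟩
    · refine Ideal.Quotient.eq.mp ((DFunLike.congr_fun hg (Ideal.Quotient.mkₐ R _ (X 0))).trans ?_)
      simp [quadLift_mk, -Ideal.Quotient.mkₐ_eq_mk]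
      rfl
    · refine Ideal.Quotient.eq.mp ((DFunLike.congr_fun hg (Ideal.Quotient.mkₐ R _ (X 1))).trans ?_)
      simp [quadLift_mk, -Ideal.Quotient.mkₐ_eq_mk]
      rfl
    · exact (map_quadValue g a b c _ _).symm.trans ((congrArg g (quadValue_X a b c)).trans g.map_one)
  · intro h
    have : Algebra.FormallySmooth R (ConicAlg a b c) := by
      refine .of_comp_surjective fun S _ _ I hI f ↦ ?_
      obtain ⟨x, hx⟩ := Ideal.Quotient.mkₐ_surjective R I (f (Ideal.Quotient.mkₐ R _ (X 0)))
      obtain ⟨y, hy⟩ := Ideal.Quotient.mkₐ_surjective R I (f (Ideal.Quotient.mkₐ R _ (X 1)))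
      have hxy : quadValue a b c x y - 1 ∈ I := by
        refine Ideal.Quotient.eq.mp ?_
        change Ideal.Quotient.mkₐ R I _ = Ideal.Quotient.mkₐ R I 1
        rw [map_quadValue, hx, hy, map_one]
        exact (map_quadValue f a b c _ _).symm.trans
          ((congrArg f (quadValue_X a b c)).trans f.map_one)
      obtain ⟨x', y', hx', hy', h'⟩ := h S I hI x y hxy
      refine ⟨quadLift a b c x' y' h', ?_⟩
      refine Ideal.Quotient.algHom_ext _ (MvPolynomial.algHom_ext fun i ↦ ?_)
      fin_cases i
      · change Ideal.Quotient.mkₐ R I (aeval ![x', y'] (X 0)) = _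
        rw [aeval_X]
        exact (Ideal.Quotient.eq.mpr hx').trans hx
      · change Ideal.Quotient.mkₐ R I (aeval ![x', y'] (X 1)) = _
        rw [aeval_X]
        exact (Ideal.Quotient.eq.mpr hy').trans hy
    exact ⟨this, finitePresentation_conicAlg a b c⟩

theorem smooth_conicAlg_swap {a b c : R} (h : Algebra.Smooth R (ConicAlg a b c)) :
    Algebra.Smooth R (ConicAlg c b a) := by
  rw [smooth_conicAlg_iff_lift] at h ⊢
  intro S _ _ I hI x y hxy
  obtain ⟨y', x', hy, hx, h'⟩ := h S I hI y x (by rwa [quadValue_swap])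
  exact ⟨x', y', hx, hy, by rwa [quadValue_swap]⟩

/-- If `2` and `b` generate the unit ideal modulo every ideal modulo which the conic has a point,
then the conic is smooth. -/
theorem smooth_conicAlg_of_exists {a b c : R}
    (h : ∀ (S : Type u) [CommRing S] [Algebra R S] (I : Ideal S) (x y : S),
      quadValue a b c x y - 1 ∈ I → ∃ m n : S, 2 * m + algebraMap R S b * n - 1 ∈ I) :
    Algebra.Smooth R (ConicAlg a b c) := by
  rw [smooth_conicAlg_iff_lift]
  intro S _ _ I hI x y hxy
  obtain ⟨m, n, hmn⟩ := h S I x y hxy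
  have mul_zero_of_mem {u v : S} (hu : u ∈ I) (hv : v ∈ I) : u * v = 0 := by
    have := Ideal.mul_mem_mul hu hv
    rwa [← pow_two, hI] at this
  obtain ⟨e, he⟩ : ∃ e, e = quadValue a b c x y - 1 := ⟨_, rfl⟩
  rw [← he] at hxy
  have hee := mul_zero_of_mem hxy hxy
  have hed := mul_zero_of_mem hxy hmn
  unfold quadValue at he ⊢
  generalize algebraMap R S a = a at *
  generalize algebraMap R S b = b at *
  generalize algebraMap R S c = c at *
  -- `p`, `q` express `2 m + b n` through the partial derivatives, modulo `e`
  let k := m - n * (2 * a * c * x * y + a * b * x ^ 2)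
  let p := k * x + n * (c * y + b * x)
  let q := k * y + n * (a * x)
  refine ⟨x - e * p, y - e * q, ?_, ?_, ?_⟩
  · rw [sub_sub_cancel_left]; exact neg_mem (I.mul_mem_right _ hxy)
  · rw [sub_sub_cancel_left]; exact neg_mem (I.mul_mem_right _ hxy)
  · linear_combination -(1 - e * (2 * k + b * n)) * he - hed +
      (a * p ^ 2 + b * p * q + c * q ^ 2) * hee - (2 * k + b * n) * hee

theorem exists_pow_three_eq_zero (K : Type u) [CommRing K] [Nontrivial K] :
    ∃ (S : Type u) (_ : CommRing S) (_ : Algebra K S) (t : S), t ^ 3 = 0 ∧ t ^ 2 ≠ 0 := by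
  refine ⟨Polynomial K ⧸ Ideal.span {(Polynomial.X : Polynomial K) ^ 3}, inferInstance,
    inferInstance, Ideal.Quotient.mk _ Polynomial.X, ?_, fun h ↦ ?_⟩
  · rw [← map_pow]
    exact Ideal.Quotient.eq_zero_iff_mem.mpr (Ideal.subset_span rfl)
  · rw [← map_pow, Ideal.Quotient.eq_zero_iff_mem, Ideal.mem_span_singleton,
      Polynomial.X_pow_dvd_iff] at h
    simpa using h 2 (by norm_num)

theorem not_smooth_conicAlg {P : Ideal R} {a b c : R} (h2 : (2 : R) ∈ P) (ha : a ∉ P)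
    (ha' : a - 1 ∈ P) (hb : b ∈ P) : ¬ Algebra.Smooth R (ConicAlg a b c) := by
  rw [smooth_conicAlg_iff_lift]
  intro h
  have hP : P ≠ ⊤ := fun hP ↦ ha (hP ▸ Submodule.mem_top)
  have : Nontrivial (R ⧸ P) := Ideal.Quotient.nontrivial_iff.mpr hP
  obtain ⟨S, _, _, t, ht3, ht2⟩ := exists_pow_three_eq_zero (R ⧸ P)
  let _ : Algebra R S := ((algebraMap (R ⧸ P) S).comp (Ideal.Quotient.mk P)).toAlgebra
  have hmem {z : R} (hz : z ∈ P) : algebraMap R S z = 0 := by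
    change algebraMap (R ⧸ P) S (Ideal.Quotient.mk P z) = 0
    rw [Ideal.Quotient.eq_zero_iff_mem.mpr hz, map_zero]
  have h2' : (2 : S) = 0 := by simpa only [map_ofNat] using hmem h2
  have ha1 : algebraMap R S a = 1 := by
    simpa [sub_eq_zero] using hmem ha'
  obtain ⟨x', y', hx, hy, h1⟩ := h S (Ideal.span {t ^ 2})
    (by
      rw [Ideal.span_singleton_pow, Ideal.span_singleton_eq_bot]
      linear_combination t * ht3) (1 + t) 0
    (by
      refine Ideal.mem_span_singleton.mpr ⟨1, ?_⟩
      simp only [quadValue, ha1]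
      linear_combination t * h2')
  obtain ⟨u, hu⟩ := Ideal.mem_span_singleton.mp hx
  obtain ⟨v, hv⟩ := Ideal.mem_span_singleton.mp hy
  obtain rfl : x' = 1 + t + t ^ 2 * u := by linear_combination hu
  obtain rfl : y' = t ^ 2 * v := by linear_combination hv
  simp only [quadValue, ha1, hmem hb] at h1
  apply ht2
  linear_combination h1 - (t + t ^ 2 * u + t ^ 3 * u) * h2' -
    (t * u ^ 2 + algebraMap R S c * t * v ^ 2) * ht3

end Conic

theorem s_sq : s ^ 2 = -5 := by
  apply Subtype.ext
  change sqrtm5 ^ 2 = -5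
  rw [sqrtm5, mul_pow, Complex.I_sq, ← Complex.ofReal_pow, Real.sq_sqrt (by norm_num)]
  norm_num

theorem mem_or_sub_one_mem (z : B) :
    z ∈ Ideal.span {(2 : B), 1 + s} ∨ z - 1 ∈ Ideal.span {(2 : B), 1 + s} := by
  set P := Ideal.span {(2 : B), 1 + s}
  have h2 : (2 : B) ∈ P := Ideal.subset_span (by simp)
  have hs : 1 + s ∈ P := Ideal.subset_span (by simp)
  obtain ⟨z, hz⟩ := z
  induction hz using Algebra.adjoin_induction with
  | mem x hx =>
    obtain rfl : x = sqrtm5 := hx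
    right
    have : s - 1 = (1 + s) - 2 := by ring
    change s - 1 ∈ P
    rw [this]
    exact sub_mem hs h2
  | algebraMap n =>
    change algebraMap ℤ B n ∈ P ∨ algebraMap ℤ B n - 1 ∈ P
    obtain ⟨k, rfl | rfl⟩ := n.even_or_odd'
    · left
      simpa using P.mul_mem_right (k : B) h2
    · right
      simpa using P.mul_mem_right (k : B) h2
  | add x y hx hy hx' hy' =>
    generalize hu : (⟨x, hx⟩ : B) = u at hx'
    generalize hv : (⟨y, hy⟩ : B) = v at hy'
    have : (⟨x + y, add_mem hx hy⟩ : B) = u + v := by rw [← hu, ← hv]; rfl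
    change (⟨x + y, add_mem hx hy⟩ : B) ∈ P ∨ (⟨x + y, add_mem hx hy⟩ : B) - 1 ∈ P
    rw [this]
    rcases hx' with h | h <;> rcases hy' with h' | h'
    · exact .inl (add_mem h h')
    · exact .inr (by simpa [add_sub_assoc] using add_mem h h')
    · exact .inr (by simpa [sub_add_eq_add_sub] using add_mem h h')
    · left
      have : u + v = (u - 1) + (v - 1) + 2 := by ring
      rw [this]
      exact add_mem (add_mem h h') h2
  | mul x y hx hy hx' hy' =>
    generalize hu : (⟨x, hx⟩ : B) = u at hx'
    generalize hv : (⟨y, hy⟩ : B) = v at hy'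
    have : (⟨x * y, mul_mem hx hy⟩ : B) = u * v := by rw [← hu, ← hv]; rfl
    change (⟨x * y, mul_mem hx hy⟩ : B) ∈ P ∨ (⟨x * y, mul_mem hx hy⟩ : B) - 1 ∈ P
    rw [this]
    rcases hx' with h | h
    · exact .inl (P.mul_mem_right _ h)
    · rcases hy' with h' | h'
      · exact .inl (P.mul_mem_left _ h')
      · right
        have : u * v - 1 = (u - 1) * v + (v - 1) := by ring
        rw [this]
        exact add_mem (P.mul_mem_right _ h) h'

theorem two_dvd_mul_of_mem {u v : B} (hu : u ∈ Ideal.span {(2 : B), 1 + s})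
    (hv : v ∈ Ideal.span {(2 : B), 1 + s}) : (2 : B) ∣ u * v := by
  obtain ⟨p, q, rfl⟩ := Ideal.mem_span_pair.mp hu
  obtain ⟨p', q', rfl⟩ := Ideal.mem_span_pair.mp hv
  refine ⟨2 * p * p' + p * q' * (1 + s) + q * p' * (1 + s) + q * q' * (s - 2), ?_⟩
  linear_combination q * q' * s_sq

theorem smooth_iff_sqrt_neg_five (a b c : B)
    (P : Ideal B) (hP : P = Ideal.span {(2 : B), 1 + s}) :
    Algebra.Smooth B (QuadAlg a b c) ↔ b ∉ P ∨ (a ∈ P ∧ b ∈ P ∧ c ∈ P) := by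
  subst hP
  have h2 : (2 : B) ∈ Ideal.span {(2 : B), 1 + s} := Ideal.subset_span (by simp)
  constructor
  · intro h
    by_contra! hne
    obtain ⟨hb, hac⟩ := hne
    by_cases ha : a ∈ Ideal.span {(2 : B), 1 + s}
    · have hc := hac ha hb
      exact not_smooth_conicAlg h2 hc ((mem_or_sub_one_mem c).resolve_left hc) hb
        (smooth_conicAlg_swap h)
    · exact not_smooth_conicAlg h2 ha ((mem_or_sub_one_mem a).resolve_left ha) hb h
  · rintro (hb | ⟨ha, hb, hc⟩)
    · have hb' := (mem_or_sub_one_mem b).resolve_left hb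
      obtain ⟨r, hr⟩ := two_dvd_mul_of_mem hb' hb'
      refine smooth_conicAlg_of_exists fun S _ _ I x y _ ↦
        ⟨algebraMap B S (r + b), algebraMap B S (-b), ?_⟩
      have : 2 * (r + b) + b * (-b) - 1 = 0 := by linear_combination -hr
      have := congrArg (algebraMap B S) this
      simp only [map_add, map_sub, map_mul, map_one, map_zero, map_ofNat] at this ⊢
      rw [this]
      exact I.zero_mem
    · obtain ⟨aa, haa⟩ := two_dvd_mul_of_mem ha ha
      obtain ⟨ab, hab⟩ := two_dvd_mul_of_mem ha hb
      obtain ⟨ac, hac⟩ := two_dvd_mul_of_mem ha hc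
      obtain ⟨bb, hbb⟩ := two_dvd_mul_of_mem hb hb
      obtain ⟨bc, hbc⟩ := two_dvd_mul_of_mem hb hc
      obtain ⟨cc, hcc⟩ := two_dvd_mul_of_mem hc hc
      refine smooth_conicAlg_of_exists fun S _ _ I x y hxy ↦ ?_
      replace haa := congrArg (algebraMap B S) haa
      replace hab := congrArg (algebraMap B S) hab
      replace hac := congrArg (algebraMap B S) hac
      replace hbb := congrArg (algebraMap B S) hbb
      replace hbc := congrArg (algebraMap B S) hbc
      replace hcc := congrArg (algebraMap B S) hcc
      simp only [map_mul, map_ofNat] at haa hab hac hbb hbc hcc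
      refine ⟨algebraMap B S aa * x ^ 4 + algebraMap B S bb * x ^ 2 * y ^ 2 +
        algebraMap B S cc * y ^ 4 + 2 * algebraMap B S ab * x ^ 3 * y +
        2 * algebraMap B S ac * x ^ 2 * y ^ 2 + 2 * algebraMap B S bc * x * y ^ 3, 0, ?_⟩
      convert I.mul_mem_right (quadValue a b c x y + 1) hxy using 1
      unfold quadValue
      linear_combination -x ^ 4 * haa - x ^ 2 * y ^ 2 * hbb - y ^ 4 * hcc -
        2 * x ^ 3 * y * hab - 2 * x ^ 2 * y ^ 2 * hac - 2 * x * y ^ 3 * hbc
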